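/- arXiv:2212.12511 — 3 statements merged into one kernel-verified Lean document; each statement's English description precedes it below -/
import Mathlib

section
/- Let (X,d_X) and (Y,d_Y) be pseudometric spaces, let γ : [0,ℓ_γ] → X and ξ : [0,ℓ_ξ] → Y be geodesics, and set ℓ = min(ℓ_γ, ℓ_ξ). Let d_⊔ be the extended pseudometric on the disjoint union X ⊔ Y which equals d_X on X × X, d_Y on Y × Y, and +∞ between X and Y, and let R be the coarsest equivalence relation on X ⊔ Y satisfying γ(t) R ξ(t) for every t ∈ [0,ℓ]. Then the quotient pseudometric d_⊔/R is given explicitly by: (d_⊔/R)(x,x') = d_X(x,x') for x, x' ∈ X; (d_⊔/R)(y,y') = d_Y(y,y') for y, y' ∈ Y; and (d_⊔/R)(x,y) = inf{ d_X(x,γ(t)) + d_Y(ξ(t),y) : t ∈ [0,ℓ] } for x ∈ X, y ∈ Y. In particular, this explicit formula defines a pseudometric on X ⊔ Y. -/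
open scoped ENNReal

/-- The quotient pseudometric `d/R` of an extended pseudometric `d` by a relation `R`. -/
noncomputable def quotDist {M : Type*} (d : M → M → ℝ≥0∞) (R : M → M → Prop)
    (x y : M) : ℝ≥0∞ :=
  ⨅ (n : ℕ) (a : Fin (n + 1) → M) (b : Fin (n + 1) → M)
    (_ : a 0 = x) (_ : b (Fin.last n) = y)
    (_ : ∀ i : Fin n, R (b i.castSucc) (a i.succ)),
    ∑ i, d (a i) (b i)

/-- The extended pseudometric on the disjoint union `X ⊔ Y`, equal to `d_X` on `X × X`,
to `d_Y` on `Y × Y`, and `+∞` between `X` and `Y`. -/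
noncomputable def sumDist {X Y : Type*} (dX : X → X → ℝ≥0∞) (dY : Y → Y → ℝ≥0∞) :
    X ⊕ Y → X ⊕ Y → ℝ≥0∞
  | Sum.inl x, Sum.inl x' => dX x x'
  | Sum.inr y, Sum.inr y' => dY y y'
  | _, _ => ⊤

/-- A function satisfying the triangle inequality, dominated by `d` and vanishing on `R`-related
pairs, is a lower bound for the quotient pseudometric `d/R`. -/
theorem le_quotDist {M : Type*} {d D : M → M → ℝ≥0∞} {R : M → M → Prop}
    (hle : ∀ x y, D x y ≤ d x y) (htri : ∀ x y z, D x z ≤ D x y + D y z)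
    (hR : ∀ x y, R x y → D x y = 0) (x y : M) : D x y ≤ quotDist d R x y := by
  have key : ∀ (n : ℕ) (a b : Fin (n + 1) → M), (∀ i : Fin n, R (b i.castSucc) (a i.succ)) →
      D (a 0) (b (Fin.last n)) ≤ ∑ i, d (a i) (b i) := by
    intro n
    induction n with
    | zero =>
      intro a b _
      simpa using hle (a 0) (b 0)
    | succ n ih =>
      intro a b h
      rw [Fin.sum_univ_castSucc]
      have h₁ := ih (fun i => a i.castSucc) (fun i => b i.castSucc) fun i => h i.castSucc
      have h₂ : D (b (Fin.last n).castSucc) (a (Fin.last (n + 1))) = 0 := hR _ _ (h (Fin.last n))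
      calc D (a 0) (b (Fin.last (n + 1)))
          ≤ D (a 0) (b (Fin.last n).castSucc) +
              (D (b (Fin.last n).castSucc) (a (Fin.last (n + 1))) +
                D (a (Fin.last (n + 1))) (b (Fin.last (n + 1)))) :=
            (htri _ _ _).trans (add_le_add_right (htri _ _ _) _)
        _ ≤ _ := by
            rw [h₂, zero_add]
            exact add_le_add h₁ (hle _ _)
  simp only [quotDist, le_iInf_iff]
  rintro n a b rfl rfl h
  exact key n a b h

theorem quotDist_le {M : Type*} (d : M → M → ℝ≥0∞) (R : M → M → Prop) (x y : M) :
    quotDist d R x y ≤ d x y := by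
  refine (iInf_le_of_le 0 <| iInf_le_of_le (fun _ => x) <| iInf_le_of_le (fun _ => y) <|
    iInf_le_of_le rfl <| iInf_le_of_le rfl <| iInf_le_of_le (fun i => i.elim0) ?_)
  simp

theorem quotDist_le_add {M : Type*} (d : M → M → ℝ≥0∞) {R : M → M → Prop} (x y : M) {u v : M}
    (h : R u v) : quotDist d R x y ≤ d x u + d v y := by
  refine (iInf_le_of_le 1 <| iInf_le_of_le ![x, v] <| iInf_le_of_le ![u, y] <|
    iInf_le_of_le rfl <| iInf_le_of_le rfl <| iInf_le_of_le (fun i => ?_) ?_)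
  · fin_cases i
    exact h
  · simp [Fin.sum_univ_two]

/-- The explicit gluing of `dX` and `dY` along the correspondence `γ t ∼ ξ t`, `t ∈ T`. -/
noncomputable def glueDistOn {X Y ι : Type*} (dX : X → X → ℝ≥0∞) (dY : Y → Y → ℝ≥0∞) (T : Set ι)
    (γ : ι → X) (ξ : ι → Y) : X ⊕ Y → X ⊕ Y → ℝ≥0∞
  | Sum.inl x, Sum.inl x' => dX x x'
  | Sum.inr y, Sum.inr y' => dY y y'
  | Sum.inl x, Sum.inr y => ⨅ t ∈ T, (dX x (γ t) + dY (ξ t) y)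
  | Sum.inr y, Sum.inl x => ⨅ t ∈ T, (dX x (γ t) + dY (ξ t) y)

section glueDistOn

variable {X Y ι : Type*} {dX : X → X → ℝ≥0∞} {dY : Y → Y → ℝ≥0∞} {T : Set ι}
  {γ : ι → X} {ξ : ι → Y}

theorem glueDistOn_self (hX : ∀ x, dX x x = 0) (hY : ∀ y, dY y y = 0) (a : X ⊕ Y) :
    glueDistOn dX dY T γ ξ a a = 0 := by
  rcases a with x | y
  · exact hX x
  · exact hY y

theorem glueDistOn_comm (hX : ∀ x y, dX x y = dX y x) (hY : ∀ x y, dY x y = dY y x)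
    (a b : X ⊕ Y) : glueDistOn dX dY T γ ξ a b = glueDistOn dX dY T γ ξ b a := by
  rcases a with x | y <;> rcases b with x' | y'
  · exact hX x x'
  · rfl
  · rfl
  · exact hY y y'

theorem glueDistOn_le_sumDist (a b : X ⊕ Y) :
    glueDistOn dX dY T γ ξ a b ≤ sumDist dX dY a b := by
  rcases a with x | y <;> rcases b with x' | y' <;> simp [glueDistOn, sumDist]

theorem glueDistOn_eq_zero (hX : ∀ x, dX x x = 0) (hY : ∀ y, dY y y = 0) {t : ι} (ht : t ∈ T) :
    glueDistOn dX dY T γ ξ (Sum.inl (γ t)) (Sum.inr (ξ t)) = 0 := by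
  refine le_antisymm (iInf₂_le_of_le t ht ?_) zero_le
  rw [hX, hY, add_zero]

theorem glueDistOn_triangle (hXs : ∀ x y, dX x y = dX y x)
    (hXt : ∀ x y z, dX x z ≤ dX x y + dX y z) (hYs : ∀ x y, dY x y = dY y x)
    (hYt : ∀ x y z, dY x z ≤ dY x y + dY y z)
    (hiso : ∀ s ∈ T, ∀ t ∈ T, dX (γ s) (γ t) = dY (ξ s) (ξ t)) (a b c : X ⊕ Y) :
    glueDistOn dX dY T γ ξ a c ≤ glueDistOn dX dY T γ ξ a b + glueDistOn dX dY T γ ξ b c := by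
  rcases a with a | a <;> rcases b with b | b <;> rcases c with c | c <;>
    simp only [glueDistOn, ENNReal.iInf_add, ENNReal.add_iInf, le_iInf_iff]
  · exact hXt a b c
  · intro t ht
    refine iInf₂_le_of_le t ht ?_
    rw [← add_assoc]
    exact add_le_add_left (hXt _ _ _) _
  · intro s hs t ht
    calc dX a c ≤ dX a (γ t) + (dX (γ t) (γ s) + dX (γ s) c) :=
          (hXt _ _ _).trans (add_le_add_right (hXt _ _ _) _)
      _ ≤ dX a (γ t) + ((dY (ξ t) b + dY b (ξ s)) + dX (γ s) c) := by
          rw [hiso t ht s hs]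
          gcongr
          exact hYt _ _ _
      _ = _ := by
          rw [hYs b, hXs _ c]
          ring
  · intro t ht
    refine iInf₂_le_of_le t ht ?_
    rw [add_assoc]
    exact add_le_add_right (hYt _ _ _) _
  · intro t ht
    refine iInf₂_le_of_le t ht ?_
    calc dX c (γ t) + dY (ξ t) a ≤ (dX c b + dX b (γ t)) + dY (ξ t) a :=
          add_le_add_left (hXt _ _ _) _
      _ = _ := by
          rw [hXs c b]
          ring
  · intro s hs t ht
    calc dY a c ≤ dY a (ξ t) + (dY (ξ t) (ξ s) + dY (ξ s) c) :=
          (hYt _ _ _).trans (add_le_add_right (hYt _ _ _) _)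
      _ ≤ dY a (ξ t) + ((dX (γ t) b + dX b (γ s)) + dY (ξ s) c) := by
          rw [← hiso t ht s hs]
          gcongr
          exact hXt _ _ _
      _ = _ := by
          rw [hYs a, hXs _ b]
          ring
  · intro t ht
    refine iInf₂_le_of_le t ht ?_
    calc dX c (γ t) + dY (ξ t) a ≤ dX c (γ t) + (dY (ξ t) b + dY b a) :=
          add_le_add_right (hYt _ _ _) _
      _ = _ := by
          rw [hYs b a]
          ring
  · exact hYt a b c

end glueDistOn

/-- explicit formula for the metric gluing of two pseudometric spaces along
geodesics `γ` and `ξ`, and the fact that it defines a pseudometric on `X ⊔ Y`. -/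
theorem quotDist_glue_two_spaces {X Y : Type*}
    (dX : X → X → ℝ≥0∞)
    (hdX_symm : ∀ x y, dX x y = dX y x) (hdX_refl : ∀ x, dX x x = 0)
    (hdX_triangle : ∀ x y z, dX x z ≤ dX x y + dX y z)
    (dY : Y → Y → ℝ≥0∞)
    (hdY_symm : ∀ x y, dY x y = dY y x) (hdY_refl : ∀ x, dY x x = 0)
    (hdY_triangle : ∀ x y z, dY x z ≤ dY x y + dY y z)
    (ℓγ ℓξ : ℝ) (hℓγ : 0 ≤ ℓγ) (hℓξ : 0 ≤ ℓξ)
    (γ : ℝ → X) (ξ : ℝ → Y)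
    (hγ : ∀ s ∈ Set.Icc (0:ℝ) ℓγ, ∀ t ∈ Set.Icc (0:ℝ) ℓγ,
      dX (γ s) (γ t) = ENNReal.ofReal |s - t|)
    (hξ : ∀ s ∈ Set.Icc (0:ℝ) ℓξ, ∀ t ∈ Set.Icc (0:ℝ) ℓξ,
      dY (ξ s) (ξ t) = ENNReal.ofReal |s - t|)
    (R : X ⊕ Y → X ⊕ Y → Prop) (hR : Equivalence R)
    (hRgen : ∀ t ∈ Set.Icc (0:ℝ) (min ℓγ ℓξ), R (Sum.inl (γ t)) (Sum.inr (ξ t)))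
    (hRmin : ∀ S : X ⊕ Y → X ⊕ Y → Prop, Equivalence S →
      (∀ t ∈ Set.Icc (0:ℝ) (min ℓγ ℓξ), S (Sum.inl (γ t)) (Sum.inr (ξ t))) →
      ∀ a b, R a b → S a b) :
    (∀ x x' : X, quotDist (sumDist dX dY) R (Sum.inl x) (Sum.inl x') = dX x x') ∧
    (∀ y y' : Y, quotDist (sumDist dX dY) R (Sum.inr y) (Sum.inr y') = dY y y') ∧
    (∀ (x : X) (y : Y), quotDist (sumDist dX dY) R (Sum.inl x) (Sum.inr y) =
      ⨅ t ∈ Set.Icc (0:ℝ) (min ℓγ ℓξ), (dX x (γ t) + dY (ξ t) y)) ∧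
    (∀ a, quotDist (sumDist dX dY) R a a = 0) ∧
    (∀ a b, quotDist (sumDist dX dY) R a b = quotDist (sumDist dX dY) R b a) ∧
    (∀ a b c, quotDist (sumDist dX dY) R a c ≤
      quotDist (sumDist dX dY) R a b + quotDist (sumDist dX dY) R b c) := by
  set T := Set.Icc (0:ℝ) (min ℓγ ℓξ) with hT
  have hiso : ∀ s ∈ T, ∀ t ∈ T, dX (γ s) (γ t) = dY (ξ s) (ξ t) := by
    intro s hs t ht
    rw [hγ s ⟨hs.1, hs.2.trans (min_le_left _ _)⟩ t ⟨ht.1, ht.2.trans (min_le_left _ _)⟩,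
      hξ s ⟨hs.1, hs.2.trans (min_le_right _ _)⟩ t ⟨ht.1, ht.2.trans (min_le_right _ _)⟩]
  have self := glueDistOn_self (T := T) (γ := γ) (ξ := ξ) hdX_refl hdY_refl
  have comm := glueDistOn_comm (T := T) (γ := γ) (ξ := ξ) hdX_symm hdY_symm
  have tri := glueDistOn_triangle hdX_symm hdX_triangle hdY_symm hdY_triangle hiso
  have hzero : ∀ a b, R a b → glueDistOn dX dY T γ ξ a b = 0 :=
    hRmin _ ⟨self, fun {a b} h => (comm b a).trans h, fun {a b c} h₁ h₂ =>
      le_antisymm ((tri a b c).trans (by rw [h₁, h₂, add_zero])) zero_le⟩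
      fun t ht => glueDistOn_eq_zero hdX_refl hdY_refl ht
  have heq : ∀ a b, quotDist (sumDist dX dY) R a b = glueDistOn dX dY T γ ξ a b := by
    intro a b
    refine le_antisymm ?_ (le_quotDist glueDistOn_le_sumDist tri hzero a b)
    rcases a with x | y <;> rcases b with x' | y'
    · exact quotDist_le _ _ _ _
    · exact le_iInf₂ fun t ht => quotDist_le_add (sumDist dX dY) _ _ (hRgen t ht)
    · refine le_iInf₂ fun t ht =>
        (quotDist_le_add (sumDist dX dY) _ _ (hR.symm (hRgen t ht))).trans_eq ?_
      rw [add_comm, hdX_symm x', hdY_symm _ y]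
      rfl
    · exact quotDist_le _ _ _ _
  simp only [heq]
  exact ⟨fun _ _ => rfl, fun _ _ => rfl, fun _ _ => rfl, self, comm, tri⟩
end

section
/- Let (f,g) be a quadrilateral trajectory on I. Set Γ_0(r) = inf{s ∈ I : s ≥ 0 and g(s) = g(0) − r}, defined for real 0 ≤ r ≤ g(0) − inf_{I_+} g, and Ξ_0(r) = sup{s ∈ I : s ≤ 0 and g(s) = g(0) − r}, defined for real 0 ≤ r ≤ g(0) − inf_{I_-} g. Let R₀ be the coarsest equivalence relation on I containing all pairs (Γ_0(r), Ξ_0(r)) for 0 ≤ r ≤ g(0) − max(inf_{I_+} g, inf_{I_-} g) (all r ≥ 0 when this bound is +∞, i.e. when both infima are −∞). Then d_g/{d_f = 0} = (d̈_g/{d_f = 0})/R₀ as functions on I × I; that is, D_{f,g} = D̈_{f,g}/R₀. -/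
open scoped ENNReal

/-- The tree pseudometric `d_f(s,t) = f(s) + f(t) − 2·inf{f(u) : s∧t ≤ u ≤ s∨t}`. -/
noncomputable def dOf (f : ℝ → ℝ) (s t : ℝ) : ℝ :=
  f s + f t - 2 * sInf (f '' Set.Icc (min s t) (max s t))

/-- The quotient pseudometric `d/R`, with chain points constrained to lie in `S`. -/
noncomputable def quotDistOn {α : Type*} (d : α → α → ℝ≥0∞) (R : α → α → Prop)
    (S : Set α) (x y : α) : ℝ≥0∞ :=
  ⨅ (n : ℕ) (a : Fin (n + 1) → α) (b : Fin (n + 1) → α)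
    (_ : ∀ i, a i ∈ S) (_ : ∀ i, b i ∈ S)
    (_ : a 0 = x) (_ : b (Fin.last n) = y)
    (_ : ∀ i : Fin n, R (b i.castSucc) (a i.succ)),
    ∑ i, d (a i) (b i)

/-- A quadrilateral trajectory. -/
def IsQuadTrajectory (I : Set ℝ) (f g : ℝ → ℝ) : Prop :=
  IsClosed I ∧ I.OrdConnected ∧ 0 ∈ interior I ∧
  ContinuousOn f I ∧ ContinuousOn g I ∧
  (∀ s ∈ I, ∀ t ∈ I, dOf f s t = 0 → g s = g t) ∧
  (⨅ t ∈ I ∩ Set.Iic 0, (f t : EReal)) = (⨅ t ∈ I ∩ Set.Ici 0, (f t : EReal)) ∧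
  (Bornology.IsBounded I ∨ I = Set.univ) ∧
  (I = Set.univ →
    ¬ BddBelow (f '' Set.Ici 0) ∧ ¬ BddBelow (f '' Set.Iic 0) ∧
    ¬ BddBelow (g '' Set.Ici 0) ∧ ¬ BddBelow (g '' Set.Iic 0))

open Classical in
/-- `d̈_g(s,t)`: equal to `d_g(s,t)` if `s` and `t` lie both in `A` or both in `B`,
and `+∞` otherwise. -/
noncomputable def ddotG (g : ℝ → ℝ) (A B : Set ℝ) (s t : ℝ) : ℝ≥0∞ :=
  if (s ∈ A ∧ t ∈ A) ∨ (s ∈ B ∧ t ∈ B) then ENNReal.ofReal (dOf g s t) else ⊤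

/-- Admissibility of `r` for the gluing relation `R₀`:
`0 ≤ r ≤ g(0) − max(inf_{I_+} g, inf_{I_-} g)` (any `r ≥ 0` when the bound is `+∞`). -/
def quadAdm (I : Set ℝ) (g : ℝ → ℝ) (r : ℝ) : Prop :=
  0 ≤ r ∧ (r : EReal) ≤ (g 0 : EReal) -
    max (⨅ u ∈ I ∩ Set.Ici 0, (g u : EReal)) (⨅ u ∈ I ∩ Set.Iic 0, (g u : EReal))

/-- `Γ_0(r) = inf{s ∈ I : s ≥ 0, g(s) = g(0) − r}`. -/
noncomputable def gamZero (I : Set ℝ) (g : ℝ → ℝ) (r : ℝ) : ℝ :=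
  sInf {s | s ∈ I ∧ 0 ≤ s ∧ g s = g 0 - r}

/-- `Ξ_0(r) = sup{s ∈ I : s ≤ 0, g(s) = g(0) − r}`. -/
noncomputable def xiZero (I : Set ℝ) (g : ℝ → ℝ) (r : ℝ) : ℝ :=
  sSup {s | s ∈ I ∧ s ≤ 0 ∧ g s = g 0 - r}

section QuotDist

variable {α : Type*} {d : α → α → ℝ≥0∞} {R : α → α → Prop} {S : Set α} {x y z : α}

/-- A function that is subadditive along single chain steps is subadditive for the quotient
pseudometric. -/
lemma le_quotDistOn_add (F : α → ℝ≥0∞)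
    (hF : ∀ x ∈ S, ∀ y ∈ S, ∀ z ∈ S, R y z → F x ≤ d x y + F z) (hy : R y y) :
    F x ≤ quotDistOn d R S x y + F y := by
  have key : ∀ (n : ℕ) (a b : Fin (n + 1) → α), (∀ i, a i ∈ S) → (∀ i, b i ∈ S) →
      b (Fin.last n) = y → (∀ i : Fin n, R (b i.castSucc) (a i.succ)) →
      F (a 0) ≤ ∑ i, d (a i) (b i) + F y := by
    intro n
    induction n with
    | zero =>
      intro a b ha hb hl _
      have hb0 : b 0 = y := hl
      have := hF (a 0) (ha 0) (b 0) (hb 0) (b 0) (hb 0) (by rwa [hb0])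
      simpa [hb0] using this
    | succ n ih =>
      intro a b ha hb hl hR
      have h1 := hF (a 0) (ha 0) (b 0) (hb 0) (a 1) (ha 1) (hR 0)
      have h2 := ih (fun i => a i.succ) (fun i => b i.succ) (fun i => ha _) (fun i => hb _)
        hl (fun i => hR i.succ)
      calc F (a 0) ≤ d (a 0) (b 0) + F (a 1) := h1
        _ ≤ d (a 0) (b 0) + (∑ i : Fin (n + 1), d (a i.succ) (b i.succ) + F y) :=
          add_le_add le_rfl h2
        _ = ∑ i, d (a i) (b i) + F y := by
          rw [Fin.sum_univ_succ (fun i => d (a i) (b i))]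
          exact (add_assoc _ _ _).symm
  simp only [quotDistOn, ENNReal.iInf_add]
  refine le_iInf fun n => le_iInf fun a => le_iInf fun b => le_iInf fun ha => le_iInf fun hb =>
    le_iInf fun h0 => le_iInf fun hl => le_iInf fun hR => ?_
  rw [← h0]
  exact key n a b ha hb hl hR

lemma quotDistOn_le_sum (n : ℕ) (a b : Fin (n + 1) → α) (ha : ∀ i, a i ∈ S) (hb : ∀ i, b i ∈ S)
    (hR : ∀ i : Fin n, R (b i.castSucc) (a i.succ)) :
    quotDistOn d R S (a 0) (b (Fin.last n)) ≤ ∑ i, d (a i) (b i) :=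
  iInf_le_of_le n <| iInf_le_of_le a <| iInf_le_of_le b <| iInf_le_of_le ha <|
    iInf_le_of_le hb <| iInf_le_of_le rfl <| iInf_le_of_le rfl <| iInf_le_of_le hR le_rfl

lemma quotDistOn_le (hx : x ∈ S) (hy : y ∈ S) : quotDistOn d R S x y ≤ d x y := by
  simpa using quotDistOn_le_sum (d := d) (R := R) (S := S) 0 (fun _ => x) (fun _ => y)
    (fun _ => hx) (fun _ => hy) (fun i => i.elim0)

lemma quotDistOn_le_add {w : α} (hx : x ∈ S) (hy : y ∈ S) (hR : R y z) :
    quotDistOn d R S x w ≤ d x y + quotDistOn d R S z w := by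
  conv_rhs => unfold quotDistOn
  simp only [ENNReal.add_iInf]
  refine le_iInf fun n => le_iInf fun a => le_iInf fun b => le_iInf fun ha => le_iInf fun hb =>
    le_iInf fun h0 => le_iInf fun hl => le_iInf fun hR' => ?_
  have := quotDistOn_le_sum (d := d) (R := R) (S := S) (n + 1)
    (Fin.cons x a : Fin (n + 2) → α) (Fin.cons y b : Fin (n + 2) → α)
    (fun i => by cases i using Fin.cases <;> simp [hx, ha])
    (fun i => by cases i using Fin.cases <;> simp [hy, hb])
    (fun i => by
      cases i using Fin.cases with
      | zero => simpa [h0] using hR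
      | succ i => simpa using hR' i)
  rw [Fin.sum_univ_succ] at this
  simpa [← Fin.succ_last, hl] using this

lemma quotDistOn_triangle (hy : R y y) :
    quotDistOn d R S x z ≤ quotDistOn d R S x y + quotDistOn d R S y z :=
  le_quotDistOn_add (fun x => quotDistOn d R S x z)
    (fun _ hx _ hy _ _ hR => quotDistOn_le_add hx hy hR) hy

lemma quotDistOn_mono {d' : α → α → ℝ≥0∞} (h : ∀ x y, d x y ≤ d' x y) :
    quotDistOn d R S x y ≤ quotDistOn d' R S x y := by
  unfold quotDistOn
  gcongr
  exact h _ _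

/-- Related points are at quotient distance zero if the distance vanishes on the diagonal. -/
lemma quotDistOn_eq_zero (hd : ∀ x ∈ S, d x x = 0) (hx : x ∈ S) (hy : y ∈ S) (hR : R x y) :
    quotDistOn d R S x y = 0 := by
  have h1 : quotDistOn d R S x y ≤ d x x + quotDistOn d R S y y := quotDistOn_le_add hx hx hR
  have h2 : quotDistOn d R S y y ≤ d y y := quotDistOn_le hy hy
  rw [hd y hy] at h2
  rw [hd x hx, le_antisymm h2 zero_le] at h1
  simpa using h1

end QuotDist

section TreePseudometric

variable {I : Set ℝ} {f g : ℝ → ℝ} {a b c r w : ℝ}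

lemma dOf_self (f : ℝ → ℝ) (s : ℝ) : dOf f s s = 0 := by
  simp [dOf]; ring

lemma dOf_comm (f : ℝ → ℝ) (s t : ℝ) : dOf f s t = dOf f t s := by
  simp only [dOf, min_comm s t, max_comm s t]; ring

lemma dOf_le (hab : a ≤ b) (h : ∀ s ∈ Set.Icc a b, c ≤ g s) :
    dOf g a b ≤ g a + g b - 2 * c := by
  have : c ≤ sInf (g '' Set.Icc a b) := by
    refine le_csInf ((Set.nonempty_Icc.2 hab).image g) ?_
    rintro _ ⟨s, hs, rfl⟩
    exact h s hs
  simp only [dOf, min_eq_left hab, max_eq_right hab]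
  linarith

lemma le_dOf (hg : ContinuousOn g (Set.Icc a b)) (hab : a ≤ b) (hw : w ∈ Set.Icc a b) :
    g a + g b - 2 * g w ≤ dOf g a b := by
  have : sInf (g '' Set.Icc a b) ≤ g w :=
    csInf_le (isCompact_Icc.image_of_continuousOn hg).bddBelow ⟨w, hw, rfl⟩
  simp only [dOf, min_eq_left hab, max_eq_right hab]
  linarith

/-- The intermediate value theorem from `0` to `w`, on an order-connected set. -/
lemma exists_eq_of_le (hI : I.OrdConnected) (h0 : 0 ∈ I) (hg : ContinuousOn g I) (hw : w ∈ I)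
    (h1 : g w ≤ c) (h2 : c ≤ g 0) : ∃ s ∈ I, s ∈ Set.uIcc 0 w ∧ g s = c := by
  have hsub : Set.uIcc 0 w ⊆ I := hI.uIcc_subset h0 hw
  obtain ⟨s, hs, rfl⟩ := intermediate_value_uIcc (hg.mono hsub) (Set.mem_uIcc_of_ge h1 h2)
  exact ⟨s, hsub hs, hs, rfl⟩

lemma gamZero_spec (hIc : IsClosed I) (hI : I.OrdConnected) (h0 : 0 ∈ I) (hg : ContinuousOn g I)
    (hr : 0 ≤ r) (hwI : w ∈ I) (hw0 : 0 ≤ w) (hw : g w = g 0 - r) :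
    gamZero I g r ∈ I ∧ 0 ≤ gamZero I g r ∧ gamZero I g r ≤ w ∧
      g (gamZero I g r) = g 0 - r ∧ ∀ s ∈ Set.Icc 0 (gamZero I g r), g 0 - r ≤ g s := by
  have hcl : IsClosed {s | s ∈ I ∧ 0 ≤ s ∧ g s = g 0 - r} := by
    have := (hg.preimage_isClosed_of_isClosed hIc
      (isClosed_singleton (x := g 0 - r))).inter (isClosed_Ici (a := (0 : ℝ)))
    convert this using 1
    ext s
    simp only [Set.mem_ofPred_eq, Set.mem_inter_iff, Set.mem_preimage, Set.mem_singleton_iff,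
      Set.mem_Ici]
    tauto
  have hbdd : BddBelow {s | s ∈ I ∧ 0 ≤ s ∧ g s = g 0 - r} := ⟨0, fun s hs => hs.2.1⟩
  obtain ⟨h1, h2, h3⟩ := hcl.csInf_mem ⟨w, hwI, hw0, hw⟩ hbdd
  refine ⟨h1, h2, csInf_le hbdd ⟨hwI, hw0, hw⟩, h3, fun s hs => ?_⟩
  by_contra! hlt
  obtain ⟨p, hpI, hp, hgp⟩ := exists_eq_of_le hI h0 hg (hI.out h0 h1 hs) hlt.le (by linarith)
  rw [Set.uIcc_of_le hs.1] at hp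
  have h4 : gamZero I g r ≤ p := csInf_le hbdd ⟨hpI, hp.1, hgp⟩
  have h5 : s = p := le_antisymm (hs.2.trans h4) hp.2
  subst h5
  linarith

lemma xiZero_spec (hIc : IsClosed I) (hI : I.OrdConnected) (h0 : 0 ∈ I) (hg : ContinuousOn g I)
    (hr : 0 ≤ r) (hwI : w ∈ I) (hw0 : w ≤ 0) (hw : g w = g 0 - r) :
    xiZero I g r ∈ I ∧ xiZero I g r ≤ 0 ∧ w ≤ xiZero I g r ∧
      g (xiZero I g r) = g 0 - r ∧ ∀ s ∈ Set.Icc (xiZero I g r) 0, g 0 - r ≤ g s := by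
  have hcl : IsClosed {s | s ∈ I ∧ s ≤ 0 ∧ g s = g 0 - r} := by
    have := (hg.preimage_isClosed_of_isClosed hIc
      (isClosed_singleton (x := g 0 - r))).inter (isClosed_Iic (a := (0 : ℝ)))
    convert this using 1
    ext s
    simp only [Set.mem_ofPred_eq, Set.mem_inter_iff, Set.mem_preimage, Set.mem_singleton_iff,
      Set.mem_Iic]
    tauto
  have hbdd : BddAbove {s | s ∈ I ∧ s ≤ 0 ∧ g s = g 0 - r} := ⟨0, fun s hs => hs.2.1⟩
  obtain ⟨h1, h2, h3⟩ := hcl.csSup_mem ⟨w, hwI, hw0, hw⟩ hbdd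
  refine ⟨h1, h2, le_csSup hbdd ⟨hwI, hw0, hw⟩, h3, fun s hs => ?_⟩
  by_contra! hlt
  obtain ⟨p, hpI, hp, hgp⟩ := exists_eq_of_le hI h0 hg (hI.out h1 h0 hs) hlt.le (by linarith)
  rw [Set.uIcc_of_ge hs.2] at hp
  have h4 : p ≤ xiZero I g r := le_csSup hbdd ⟨hpI, hp.2, hgp⟩
  have h5 : s = p := le_antisymm hp.1 (h4.trans hs.1)
  subst h5
  linarith

/-- A level at or above the infimum of `g` on the half-line part `I ∩ J` is undershot there, as
soon as `I ∩ J` is compact or `g` is unbounded below on it. -/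
lemma exists_le_of_iInf_le {J : Set ℝ} (hne : (I ∩ J).Nonempty) (hg : ContinuousOn g I)
    (hIJ : IsCompact (I ∩ J) ∨ ¬ BddBelow (g '' (I ∩ J)))
    (h : (⨅ u ∈ I ∩ J, (g u : EReal)) ≤ (c : EReal)) : ∃ w ∈ I ∩ J, g w ≤ c := by
  rcases hIJ with hK | hb
  · obtain ⟨v, hv, hmin⟩ := hK.exists_isMinOn hne (hg.mono Set.inter_subset_left)
    refine ⟨v, hv, ?_⟩
    have : (g v : EReal) ≤ ⨅ u ∈ I ∩ J, (g u : EReal) :=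
      le_iInf₂ fun u hu => EReal.coe_le_coe_iff.2 (hmin hu)
    exact EReal.coe_le_coe_iff.1 (this.trans h)
  · rw [not_bddBelow_iff] at hb
    obtain ⟨_, ⟨w, hw, rfl⟩, hlt⟩ := hb c
    exact ⟨w, hw, hlt.le⟩

lemma le_coe_sub_of_coe_le_sub {A : EReal} {s : ℝ} (h : (r : EReal) ≤ (s : EReal) - A) :
    A ≤ ((s - r : ℝ) : EReal) := by
  induction A with
  | bot => exact bot_le
  | top => simp at h
  | coe x =>
    rw [← EReal.coe_sub, EReal.coe_le_coe_iff] at h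
    rw [EReal.coe_le_coe_iff]
    linarith

lemma exists_gamZero_xiZero_level (h : IsQuadTrajectory I f g) (hr : quadAdm I g r) :
    (∃ w ∈ I, 0 ≤ w ∧ g w = g 0 - r) ∧ ∃ w ∈ I, w ≤ 0 ∧ g w = g 0 - r := by
  obtain ⟨hIc, hI, h0, -, hg, -, -, hb, huniv⟩ := h
  have h0 := interior_subset h0
  have hmax := le_coe_sub_of_coe_le_sub hr.2
  have hcase : (IsCompact (I ∩ Set.Ici 0) ∨ ¬ BddBelow (g '' (I ∩ Set.Ici 0))) ∧
      (IsCompact (I ∩ Set.Iic 0) ∨ ¬ BddBelow (g '' (I ∩ Set.Iic 0))) := by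
    rcases hb with hb | rfl
    · have hK := Metric.isCompact_of_isClosed_isBounded hIc hb
      exact ⟨.inl (hK.inter_right isClosed_Ici), .inl (hK.inter_right isClosed_Iic)⟩
    · obtain ⟨-, -, h1, h2⟩ := huniv rfl
      exact ⟨.inr (by simpa using h1), .inr (by simpa using h2)⟩
  obtain ⟨u, ⟨huI, hu0⟩, hu⟩ := exists_le_of_iInf_le ⟨0, h0, Set.self_mem_Ici⟩ hg hcase.1
    ((le_max_left _ _).trans hmax)
  obtain ⟨v, ⟨hvI, hv0⟩, hv⟩ := exists_le_of_iInf_le ⟨0, h0, Set.self_mem_Iic⟩ hg hcase.2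
    ((le_max_right _ _).trans hmax)
  have hle : g 0 - r ≤ g 0 := by linarith [hr.1]
  obtain ⟨p, hpI, hp, hgp⟩ := exists_eq_of_le hI h0 hg huI hu hle
  obtain ⟨q, hqI, hq, hgq⟩ := exists_eq_of_le hI h0 hg hvI hv hle
  rw [Set.uIcc_of_le hu0] at hp
  rw [Set.uIcc_of_ge hv0] at hq
  exact ⟨⟨p, hpI, hp.1, hgp⟩, ⟨q, hqI, hq.2, hgq⟩⟩

lemma gamZero_xiZero_identified (h : IsQuadTrajectory I f g) (hr : quadAdm I g r) :
    gamZero I g r ∈ I ∧ xiZero I g r ∈ I ∧ dOf g (xiZero I g r) (gamZero I g r) ≤ 0 := by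
  obtain ⟨⟨p, hpI, hp0, hp⟩, q, hqI, hq0, hq⟩ := exists_gamZero_xiZero_level h hr
  obtain ⟨hIc, hI, h0, -, hg, -⟩ := h
  have h0 := interior_subset h0
  obtain ⟨hG, hG0, -, hGv, hGl⟩ := gamZero_spec hIc hI h0 hg hr.1 hpI hp0 hp
  obtain ⟨hX, hX0, -, hXv, hXl⟩ := xiZero_spec hIc hI h0 hg hr.1 hqI hq0 hq
  refine ⟨hG, hX, ?_⟩
  have := dOf_le (g := g) (c := g 0 - r) (hX0.trans hG0) fun s hs => by
    rcases le_total s 0 with hs0 | hs0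
    · exact hXl s ⟨hs.1, hs0⟩
    · exact hGl s ⟨hs0, hs.2⟩
  linarith

/-- A tree geodesic crossing `0` splits through a pair of glued points. -/
lemma exists_split (h : IsQuadTrajectory I f g) (ha : a ∈ I) (hb : b ∈ I) (ha0 : a ≤ 0)
    (hb0 : 0 ≤ b) :
    ∃ r, quadAdm I g r ∧ gamZero I g r ∈ I ∩ Set.Ici 0 ∧ xiZero I g r ∈ I ∩ Set.Iic 0 ∧
      ENNReal.ofReal (dOf g a (xiZero I g r)) + ENNReal.ofReal (dOf g (gamZero I g r) b) ≤
        ENNReal.ofReal (dOf g a b) := by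
  obtain ⟨hIc, hI, h0, -, hg, -⟩ := h
  have h0 := interior_subset h0
  obtain ⟨u, hu, humin⟩ := isCompact_Icc.exists_isMinOn (Set.nonempty_Icc.2 ha0)
    (hg.mono (hI.out ha h0))
  obtain ⟨v, hv, hvmin⟩ := isCompact_Icc.exists_isMinOn (Set.nonempty_Icc.2 hb0)
    (hg.mono (hI.out h0 hb))
  have huI := hI.out ha h0 hu
  have hvI := hI.out h0 hb hv
  have hgu : g u ≤ g 0 := humin ⟨ha0, le_rfl⟩
  have hgv : g v ≤ g 0 := hvmin ⟨le_rfl, hb0⟩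
  set m := max (g u) (g v) with hm
  have hm0 : m ≤ g 0 := max_le hgu hgv
  obtain ⟨p, hpI, hp, hgp⟩ := exists_eq_of_le hI h0 hg hvI (le_max_right _ _ : g v ≤ m) hm0
  obtain ⟨q, hqI, hq, hgq⟩ := exists_eq_of_le hI h0 hg huI (le_max_left _ _ : g u ≤ m) hm0
  rw [Set.uIcc_of_le hv.1] at hp
  rw [Set.uIcc_of_ge hu.2] at hq
  have hr : 0 ≤ g 0 - m := by linarith
  obtain ⟨hG, hG0, hGp, hGv, -⟩ := gamZero_spec hIc hI h0 hg hr hpI hp.1 (by linarith)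
  obtain ⟨hX, hX0, hXq, hXv, -⟩ := xiZero_spec hIc hI h0 hg hr hqI hq.2 (by linarith)
  have hGb := hGp.trans (hp.2.trans hv.2)
  have haX := (hu.1.trans hq.1).trans hXq
  refine ⟨g 0 - m, ⟨hr, ?_⟩, ⟨hG, hG0⟩, ⟨hX, hX0⟩, ?_⟩
  · rw [EReal.coe_sub]
    refine EReal.sub_le_sub le_rfl ?_
    rw [hm, EReal.coe_strictMono.monotone.map_max]
    have h1 : (⨅ s ∈ I ∩ Set.Ici 0, (g s : EReal)) ≤ g v := iInf₂_le v ⟨hvI, hv.1⟩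
    have h2 : (⨅ s ∈ I ∩ Set.Iic 0, (g s : EReal)) ≤ g u := iInf₂_le u ⟨huI, hu.2⟩
    exact (max_le_max h1 h2).trans (max_comm _ _).le
  · have h1 := dOf_le haX fun s hs => humin ⟨hs.1, hs.2.trans hX0⟩
    have h2 := dOf_le hGb fun s hs => hvmin ⟨hG0.trans hs.1, hs.2⟩
    have hcont := hg.mono (hI.out ha hb)
    have hab := ha0.trans hb0
    have h3 := le_dOf hcont hab ⟨hu.1, hu.2.trans hb0⟩
    have h4 := le_dOf hcont hab ⟨ha0.trans hv.1, hv.2⟩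
    have h5 := le_dOf (hg.mono (hI.out ha hX)) haX (Set.left_mem_Icc.2 haX)
    have h6 := le_dOf (hg.mono (hI.out ha hX)) haX (Set.right_mem_Icc.2 haX)
    have h7 := le_dOf (hg.mono (hI.out hG hb)) hGb (Set.left_mem_Icc.2 hGb)
    have h8 := le_dOf (hg.mono (hI.out hG hb)) hGb (Set.right_mem_Icc.2 hGb)
    rw [← ENNReal.ofReal_add (by linarith) (by linarith)]
    apply ENNReal.ofReal_le_ofReal
    rcases le_total (g u) (g v) with huv | huv
    · rw [max_eq_right huv] at hm
      linarith
    · rw [max_eq_left huv] at hm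
      linarith

lemma ofReal_dOf_le_ddotG (g : ℝ → ℝ) (A B : Set ℝ) (s t : ℝ) :
    ENNReal.ofReal (dOf g s t) ≤ ddotG g A B s t := by
  unfold ddotG
  split_ifs
  exacts [le_rfl, le_top]

end TreePseudometric

/-- `D_{f,g} = D̈_{f,g}/R₀`, where `R₀` is the coarsest equivalence relation
identifying `Γ_0(r)` with `Ξ_0(r)` for admissible `r`. -/
theorem quad_glue_zero_geodesics
    (I : Set ℝ) (f g : ℝ → ℝ) (h : IsQuadTrajectory I f g)
    (R₀ : ℝ → ℝ → Prop) (hR₀ : Equivalence R₀)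
    (hgen : ∀ r : ℝ, quadAdm I g r → R₀ (gamZero I g r) (xiZero I g r))
    (hmin : ∀ S : ℝ → ℝ → Prop, Equivalence S →
      (∀ r : ℝ, quadAdm I g r → S (gamZero I g r) (xiZero I g r)) →
      ∀ x y, R₀ x y → S x y) :
    ∀ s ∈ I, ∀ t ∈ I,
      quotDistOn (fun s t => ENNReal.ofReal (dOf g s t)) (fun s t => dOf f s t = 0) I s t =
      quotDistOn
        (quotDistOn (ddotG g (I ∩ Set.Iic 0) (I ∩ Set.Ici 0))
          (fun s t => dOf f s t = 0) I)
        R₀ I s t := by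
  intro s hs t ht
  set dg : ℝ → ℝ → ℝ≥0∞ := fun s t => ENNReal.ofReal (dOf g s t) with hdg
  set Rf : ℝ → ℝ → Prop := fun s t => dOf f s t = 0 with hRf
  set dd := ddotG g (I ∩ Set.Iic 0) (I ∩ Set.Ici 0) with hdd
  set DD := quotDistOn dd Rf I with hDD
  have hRfr : ∀ x, Rf x x := dOf_self f
  have hdg0 : ∀ x ∈ I, dg x x = 0 := fun x _ => by simp [hdg, dOf_self]
  have hneg : ∀ {x y}, x ∈ I → x ≤ 0 → y ∈ I → y ≤ 0 → dd x y = dg x y :=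
    fun hx hx0 hy hy0 => if_pos (.inl ⟨⟨hx, hx0⟩, ⟨hy, hy0⟩⟩)
  have hpos : ∀ {x y}, x ∈ I → 0 ≤ x → y ∈ I → 0 ≤ y → dd x y = dg x y :=
    fun hx hx0 hy hy0 => if_pos (.inr ⟨⟨hx, hx0⟩, ⟨hy, hy0⟩⟩)
  have hdd0 : ∀ x ∈ I, dd x x = 0 := fun x hx => by
    rcases le_total x 0 with hx0 | hx0
    · rw [hneg hx hx0 hx hx0, hdg0 x hx]
    · rw [hpos hx hx0 hx hx0, hdg0 x hx]
  apply le_antisymm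
  · have hinv : ∀ x y, R₀ x y → ∀ z ∈ I, quotDistOn dg Rf I x z = quotDistOn dg Rf I y z := by
      refine hmin (fun x y => ∀ z ∈ I, quotDistOn dg Rf I x z = quotDistOn dg Rf I y z)
        ⟨fun _ _ _ => rfl, fun h z hz => (h z hz).symm,
          fun h h' z hz => (h z hz).trans (h' z hz)⟩ fun r hr z hz => ?_
      obtain ⟨hG, hX, hd⟩ := gamZero_xiZero_identified h hr
      have key : ∀ {x y}, x ∈ I → y ∈ I → dOf g x y ≤ 0 →
          quotDistOn dg Rf I x z ≤ quotDistOn dg Rf I y z := fun {x y} hx hy hxy => by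
        have := quotDistOn_le_add (d := dg) (w := z) hx hy (hRfr y)
        rwa [show dg x y = 0 from ENNReal.ofReal_of_nonpos hxy, zero_add] at this
      exact le_antisymm (key hG hX (by rwa [dOf_comm])) (key hX hG hd)
    have := le_quotDistOn_add (d := DD) (R := R₀) (S := I) (x := s) (y := t)
      (fun x => quotDistOn dg Rf I x t)
      (fun x hx y hy z hz hyz => by
        rw [← hinv y z hyz t ht]
        exact (quotDistOn_triangle (hRfr y)).trans
          (add_le_add (quotDistOn_mono (ofReal_dOf_le_ddotG _ _ _)) le_rfl))
      (hR₀.refl t)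
    rwa [quotDistOn_eq_zero hdg0 ht ht (hRfr t), add_zero] at this
  · have hE : ∀ {x y}, x ∈ I → y ∈ I → quotDistOn DD R₀ I x y ≤ DD x y := quotDistOn_le
    have hD : ∀ {x y}, x ∈ I → y ∈ I → DD x y ≤ dd x y := quotDistOn_le
    have hglue : ∀ {x y p q}, x ∈ I → y ∈ I → p ∈ I → q ∈ I → R₀ p q →
        quotDistOn DD R₀ I x y ≤ dd x p + dd q y := fun hx hy hp hq hpq =>
      (quotDistOn_le_add hx hp hpq).trans
        (add_le_add (hD hx hp) ((hE hq hy).trans (hD hq hy)))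
    have hle : ∀ x ∈ I, ∀ y ∈ I, quotDistOn DD R₀ I x y ≤ dg x y := by
      intro x hx y hy
      rcases le_total x 0 with hx0 | hx0 <;> rcases le_total y 0 with hy0 | hy0
      · exact hneg hx hx0 hy hy0 ▸ (hE hx hy).trans (hD hx hy)
      · obtain ⟨r, hr, ⟨hG, hG0⟩, ⟨hX, hX0⟩, hsum⟩ := exists_split h hx hy hx0 hy0
        refine (hglue hx hy hX hG (hR₀.symm (hgen r hr))).trans ?_
        rwa [hneg hx hx0 hX hX0, hpos hG hG0 hy hy0]
      · obtain ⟨r, hr, ⟨hG, hG0⟩, ⟨hX, hX0⟩, hsum⟩ := exists_split h hy hx hy0 hx0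
        refine (hglue hx hy hG hX (hgen r hr)).trans ?_
        rw [hpos hx hx0 hG hG0, hneg hX hX0 hy hy0, add_comm]
        simpa only [hdg, dOf_comm g x, dOf_comm g _ y] using hsum
      · exact hpos hx hx0 hy hy0 ▸ (hE hx hy).trans (hD hx hy)
    have := le_quotDistOn_add (d := dg) (R := Rf) (S := I) (x := s) (y := t)
      (fun x => quotDistOn DD R₀ I x t)
      (fun x hx y hy z hz hyz => by
        have h1 : quotDistOn DD R₀ I x t ≤
            quotDistOn DD R₀ I x y + quotDistOn DD R₀ I y t := quotDistOn_triangle (hR₀.refl y)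
        have h2 : quotDistOn DD R₀ I y t ≤ DD y z + quotDistOn DD R₀ I z t :=
          quotDistOn_le_add hy hz (hR₀.refl z)
        rw [show DD y z = 0 from quotDistOn_eq_zero hdd0 hy hz hyz, zero_add] at h2
        exact h1.trans (add_le_add (hle x hx y hy) h2))
      (hRfr t)
    have h0 : quotDistOn DD R₀ I t t = 0 :=
      le_antisymm (((hE ht ht).trans (hD ht ht)).trans (hdd0 t ht).le) zero_le
    rwa [h0, add_zero] at this
end

section
/- Let X : ℝ → ℝ be continuous with X(0) = 0 and inf{X_u : u ≥ 0} = inf{X_u : u ≤ 0} = −∞. Set X̲_t = inf{X_u : u ∈ [0∧t, 0∨t]} and Π_t = X_t − 2·X̲_t. Define d_X(s,t) = X_s + X_t − 2·inf{X_u : s∧t ≤ u ≤ s∨t}, and 𝑑̃_Π(s,t) = Π_s + Π_t − 2·max( inf{Π_u : s∧t ≤ u ≤ s∨t}, min( inf{Π_u : u ≤ s∧t}, inf{Π_u : u ≥ s∨t} ) ). Then 𝑑̃_Π(s,t) = d_X(s,t) for all s, t ∈ ℝ. -/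
/-- `X̲_t`: the infimum of `X` over the closed interval with endpoints `0` and `t`. -/
noncomputable def lowX (X : ℝ → ℝ) (t : ℝ) : ℝ :=
  sInf (X '' Set.uIcc 0 t)

/-- The two-sided Pitman transform `Π = X − 2X̲` of `X`. -/
noncomputable def Pit (X : ℝ → ℝ) (t : ℝ) : ℝ :=
  X t - 2 * lowX X t

/-- The tree pseudometric `d_h(s,t) = h(s) + h(t) − 2·inf{h(u) : s∧t ≤ u ≤ s∨t}`. -/
noncomputable def dTree (h : ℝ → ℝ) (s t : ℝ) : ℝ :=
  h s + h t - 2 * sInf (h '' Set.Icc (min s t) (max s t))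

/-- The cyclic variant
`𝑑̃_h(s,t) = h(s) + h(t) − 2·max(inf_{[s∧t,s∨t]} h, min(inf_{(-∞,s∧t]} h, inf_{[s∨t,∞)} h))`. -/
noncomputable def dCyc (h : ℝ → ℝ) (s t : ℝ) : ℝ :=
  h s + h t - 2 * max (sInf (h '' Set.Icc (min s t) (max s t)))
    (min (sInf (h '' Set.Iic (min s t))) (sInf (h '' Set.Ici (max s t))))

open Set

theorem isLeast_lowX {X : ℝ → ℝ} (hX : Continuous X) (t : ℝ) :
    IsLeast (X '' uIcc 0 t) (lowX X t) :=
  (isCompact_uIcc.image hX).isLeast_sInf (nonempty_uIcc.image X)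

theorem lowX_le {X : ℝ → ℝ} (hX : Continuous X) {u t : ℝ} (hu : u ∈ uIcc 0 t) :
    lowX X t ≤ X u :=
  (isLeast_lowX hX t).2 (mem_image_of_mem X hu)

theorem lowX_anti {X : ℝ → ℝ} (hX : Continuous X) {s t : ℝ} (hs : 0 ≤ s) (hst : s ≤ t) :
    lowX X t ≤ lowX X s := by
  obtain ⟨u, hu, hus⟩ := (isLeast_lowX hX s).1
  rw [← hus]
  rw [uIcc_of_le hs] at hu
  exact lowX_le hX (by rw [uIcc_of_le (hs.trans hst)]; exact ⟨hu.1, hu.2.trans hst⟩)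

theorem lowX_nonpos {X : ℝ → ℝ} (hX : Continuous X) (hX0 : X 0 = 0) (t : ℝ) :
    lowX X t ≤ 0 :=
  hX0 ▸ lowX_le hX left_mem_uIcc

theorem neg_lowX_le_Pit {X : ℝ → ℝ} (hX : Continuous X) (t : ℝ) :
    -lowX X t ≤ Pit X t := by
  have := lowX_le hX (right_mem_uIcc (a := 0) (b := t))
  unfold Pit
  linarith

theorem Pit_nonneg {X : ℝ → ℝ} (hX : Continuous X) (hX0 : X 0 = 0) (t : ℝ) :
    0 ≤ Pit X t := by
  linarith [neg_lowX_le_Pit hX t, lowX_nonpos hX hX0 t]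

theorem Pit_zero {X : ℝ → ℝ} (hX0 : X 0 = 0) : Pit X 0 = 0 := by
  simp [Pit, lowX, hX0]

/-- If `X` returns to the level `lowX X s` between `s` and `w`, then at its first return
the Pitman transform equals `-lowX X s`. -/
theorem exists_Pit_eq_neg_lowX {X : ℝ → ℝ} (hX : Continuous X) {s w : ℝ} (hs : 0 ≤ s)
    (hsw : s ≤ w) (hw : X w ≤ lowX X s) : ∃ u ∈ Icc s w, Pit X u = -lowX X s := by
  have hK : IsCompact (Icc s w ∩ {u | X u ≤ lowX X s}) :=
    isCompact_Icc.inter_right (isClosed_le hX continuous_const)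
  obtain ⟨u, ⟨hu, hXu⟩, hmin⟩ := hK.exists_isLeast ⟨w, ⟨hsw, le_rfl⟩, hw⟩
  have hXs : lowX X s ≤ X s := lowX_le hX right_mem_uIcc
  have hXu' : X u = lowX X s := by
    obtain ⟨v, hv, hXv⟩ := intermediate_value_Icc' hu.1 hX.continuousOn ⟨hXu, hXs⟩
    have huv : u ≤ v := hmin ⟨⟨hv.1, hv.2.trans hu.2⟩, hXv.le⟩
    rwa [le_antisymm hv.2 huv] at hXv
  have hlow : lowX X u = X u := by
    refine le_antisymm (lowX_le hX right_mem_uIcc) ?_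
    obtain ⟨v, hv, hXv⟩ := (isLeast_lowX hX u).1
    rw [uIcc_of_le (hs.trans hu.1)] at hv
    rw [← hXv, hXu']
    rcases le_total v s with hvs | hsv
    · exact lowX_le hX (by rw [uIcc_of_le hs]; exact ⟨hv.1, hvs⟩)
    · by_contra! hlt
      have huv : u ≤ v := hmin ⟨⟨hsv, hv.2.trans hu.2⟩, hlt.le⟩
      rw [le_antisymm hv.2 huv, hXu'] at hlt
      exact lt_irrefl _ hlt
  exact ⟨u, hu, by rw [Pit, hlow, hXu']; ring⟩

theorem sInf_Pit_Ici {X : ℝ → ℝ} (hX : Continuous X)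
    (hpos : ¬ BddBelow (X '' Ici 0)) {t : ℝ} (ht : 0 ≤ t) :
    sInf (Pit X '' Ici t) = -lowX X t := by
  refine IsLeast.csInf_eq ⟨?_, ?_⟩
  · obtain ⟨_, ⟨w, hw0, rfl⟩, hw⟩ := not_bddBelow_iff.1 hpos (lowX X t)
    have htw : t ≤ w := by
      by_contra! h
      exact hw.not_ge (lowX_le hX (by rw [uIcc_of_le ht]; exact ⟨hw0, h.le⟩))
    obtain ⟨u, hu, h⟩ := exists_Pit_eq_neg_lowX hX ht htw hw.le
    exact ⟨u, hu.1, h⟩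
  · rintro _ ⟨u, hu, rfl⟩
    linarith [neg_lowX_le_Pit hX u, lowX_anti hX ht hu]

theorem sInf_Pit_eq_zero {X : ℝ → ℝ} (hX : Continuous X) (hX0 : X 0 = 0) {S : Set ℝ}
    (hS : 0 ∈ S) : sInf (Pit X '' S) = 0 := by
  refine IsLeast.csInf_eq ⟨⟨0, hS, Pit_zero hX0⟩, ?_⟩
  rintro _ ⟨u, -, rfl⟩
  exact Pit_nonneg hX hX0 u

theorem sInf_Pit_Icc {X : ℝ → ℝ} (hX : Continuous X) {s t : ℝ} (hs : 0 ≤ s) (hst : s ≤ t) :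
    sInf (Pit X '' Icc s t) = sInf (X '' Icc s t) - lowX X s - lowX X t := by
  have ht := hs.trans hst
  have hI : IsLeast (X '' Icc s t) (sInf (X '' Icc s t)) :=
    (isCompact_Icc.image hX).isLeast_sInf ((nonempty_Icc.2 hst).image X)
  obtain ⟨⟨w, hw, hXw⟩, hmin⟩ := hI
  rw [← hXw] at hmin ⊢
  have hlow : lowX X t = min (lowX X s) (X w) := by
    refine le_antisymm (le_min (lowX_anti hX hs hst) (lowX_le hX ?_)) ?_
    · rw [uIcc_of_le ht]
      exact ⟨hs.trans hw.1, hw.2⟩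
    · obtain ⟨v, hv, hXv⟩ := (isLeast_lowX hX t).1
      rw [uIcc_of_le ht] at hv
      rw [← hXv]
      rcases le_total v s with hvs | hsv
      · exact (min_le_left _ _).trans (lowX_le hX (by rw [uIcc_of_le hs]; exact ⟨hv.1, hvs⟩))
      · exact (min_le_right _ _).trans (hmin ⟨v, ⟨hsv, hv.2⟩, rfl⟩)
  rcases le_total (lowX X s) (X w) with h | h
  · rw [min_eq_left h] at hlow
    have hconst : ∀ u ∈ Icc s t, lowX X u = lowX X s := fun u hu =>
      le_antisymm (lowX_anti hX hs hu.1) (hlow ▸ lowX_anti hX (hs.trans hu.1) hu.2)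
    refine IsLeast.csInf_eq ⟨⟨w, hw, ?_⟩, ?_⟩
    · rw [Pit, hconst w hw, hlow]; ring
    · rintro _ ⟨u, hu, rfl⟩
      rw [Pit, hconst u hu, hlow]
      linarith [hmin ⟨u, hu, rfl⟩]
  · rw [min_eq_right h] at hlow
    refine IsLeast.csInf_eq ⟨?_, ?_⟩
    · obtain ⟨u, hu, hPu⟩ := exists_Pit_eq_neg_lowX hX hs hw.1 h
      exact ⟨u, ⟨hu.1, hu.2.trans hw.2⟩, by rw [hPu, hlow]; ring⟩
    · rintro _ ⟨u, hu, rfl⟩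
      linarith [neg_lowX_le_Pit hX u, lowX_anti hX hs hu.1]

theorem dCyc_Pit_of_nonneg {X : ℝ → ℝ} (hX : Continuous X) (hX0 : X 0 = 0) {s t : ℝ}
    (hs : 0 ≤ s) (hst : s ≤ t) : dCyc (Pit X) s t = dTree X s t := by
  have hA : 0 ≤ sInf (Pit X '' Icc s t) := by
    apply Real.sInf_nonneg
    rintro _ ⟨u, -, rfl⟩
    exact Pit_nonneg hX hX0 u
  rw [dCyc, dTree, min_eq_left hst, max_eq_right hst,
    sInf_Pit_eq_zero hX hX0 (S := Iic s) hs,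
    max_eq_left ((min_le_left _ _).trans hA), sInf_Pit_Icc hX hs hst, Pit, Pit]
  ring

theorem lowX_comp_neg (X : ℝ → ℝ) (t : ℝ) : lowX (fun u => X (-u)) t = lowX X (-t) := by
  rw [lowX, lowX, ← image_image X Neg.neg, image_neg_eq_neg, neg_uIcc, neg_zero]

theorem Pit_comp_neg (X : ℝ → ℝ) : Pit (fun u => X (-u)) = fun u => Pit X (-u) := by
  funext t
  rw [Pit, Pit, lowX_comp_neg]

theorem dTree_comm (h : ℝ → ℝ) (s t : ℝ) : dTree h s t = dTree h t s := by
  rw [dTree, dTree, min_comm, max_comm, add_comm (h s)]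

theorem dCyc_comm (h : ℝ → ℝ) (s t : ℝ) : dCyc h s t = dCyc h t s := by
  rw [dCyc, dCyc, min_comm s, max_comm s, add_comm (h s)]

theorem dTree_comp_neg (h : ℝ → ℝ) (s t : ℝ) :
    dTree (fun u => h (-u)) s t = dTree h (-s) (-t) := by
  rw [dTree, dTree, ← image_image h Neg.neg, image_neg_eq_neg, neg_Icc, min_neg_neg,
    max_neg_neg]

theorem dCyc_comp_neg (h : ℝ → ℝ) (s t : ℝ) :
    dCyc (fun u => h (-u)) s t = dCyc h (-s) (-t) := by
  simp only [dCyc, ← image_image h Neg.neg, image_neg_eq_neg, neg_Icc, neg_Iic, neg_Ici,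
    min_neg_neg, max_neg_neg]
  rw [min_comm (sInf (h '' Ici _))]

theorem sInf_Pit_Iic {X : ℝ → ℝ} (hX : Continuous X)
    (hneg : ¬ BddBelow (X '' Iic 0)) {s : ℝ} (hs : s ≤ 0) :
    sInf (Pit X '' Iic s) = -lowX X s := by
  have hpos : ¬ BddBelow ((fun u => X (-u)) '' Ici 0) := by
    rwa [← image_image X Neg.neg, image_neg_eq_neg, neg_Ici, neg_zero]
  have := sInf_Pit_Ici (hX.comp continuous_neg) hpos (neg_nonneg.2 hs)
  simp only [Function.comp_def] at this
  rwa [Pit_comp_neg, lowX_comp_neg, ← image_image (Pit X) Neg.neg, image_neg_eq_neg, neg_Ici,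
    neg_neg] at this

theorem sInf_image_Icc_eq_min_lowX {X : ℝ → ℝ} (hX : Continuous X) {s t : ℝ}
    (hs : s ≤ 0) (ht : 0 ≤ t) :
    sInf (X '' Icc s t) = min (lowX X s) (lowX X t) := by
  rw [← Icc_union_Icc_eq_Icc hs ht, image_union,
    csInf_union (isCompact_Icc.image hX).bddBelow ((nonempty_Icc.2 hs).image X)
      (isCompact_Icc.image hX).bddBelow ((nonempty_Icc.2 ht).image X),
    lowX, lowX, uIcc_of_ge hs, uIcc_of_le ht]

/-- `𝑑̃_Π = d_X` for the two-sided Pitman transform `Π` of `X`. -/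
theorem pitman_cyclic_tree_dist (X : ℝ → ℝ) (hX : Continuous X) (hX0 : X 0 = 0)
    (hpos : ¬ BddBelow (X '' Set.Ici 0)) (hneg : ¬ BddBelow (X '' Set.Iic 0)) :
    ∀ s t : ℝ, dCyc (Pit X) s t = dTree X s t := by
  intro s t
  wlog hst : s ≤ t generalizing s t
  · rw [dCyc_comm, dTree_comm]
    exact this t s (le_of_not_ge hst)
  rcases le_total 0 s with hs | hs
  · exact dCyc_Pit_of_nonneg hX hX0 hs hst
  rcases le_total t 0 with ht | ht
  · have h := dCyc_Pit_of_nonneg (X := fun u => X (-u)) (hX.comp continuous_neg)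
      (by simpa using hX0) (neg_nonneg.2 ht) (neg_le_neg hst)
    rwa [Pit_comp_neg, dCyc_comp_neg, dTree_comp_neg, neg_neg, neg_neg, dCyc_comm,
      dTree_comm] at h
  · have hmin : 0 ≤ min (-lowX X s) (-lowX X t) :=
      le_min (neg_nonneg.2 (lowX_nonpos hX hX0 s)) (neg_nonneg.2 (lowX_nonpos hX hX0 t))
    rw [dCyc, dTree, min_eq_left hst, max_eq_right hst,
      sInf_Pit_eq_zero hX hX0 (S := Icc s t) ⟨hs, ht⟩, sInf_Pit_Iic hX hneg hs,
      sInf_Pit_Ici hX hpos ht, max_eq_right hmin, sInf_image_Icc_eq_min_lowX hX hs ht,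
      min_neg_neg, Pit, Pit]
    linarith [min_add_max (lowX X s) (lowX X t)]
end
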